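/- Let p be a prime number, C a finite nonempty subset of ℚ_p, and α ∈ C. Define recursively B_0 = C and B_{i+1} = {x ∈ B_i : |x − α|_p < μ(B_i)}. Then the sets B_i strictly decrease until some B_N equals the singleton {α}, and the energy of C with center α decomposes as Σ_{x∈C} |x − α|_p = Σ_{i=0}^{N−1} (#B_i − #B_{i+1})·μ(B_i). -/

import Mathlib

open Finset
open scoped Classical

/-- The diameter `μ(C) = max {‖x - y‖ : x, y ∈ C}` of a finite set of `p`-adic numbers
(by convention `0` for the empty set, in particular `μ(C) = 0` for singletons). -/
noncomputable def mu {p : ℕ} [Fact p.Prime] (C : Finset ℚ_[p]) : ℝ :=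
  if h : C.Nonempty then (C ×ˢ C).sup' (h.product h) (fun xy => ‖xy.1 - xy.2‖) else 0

/-- The iterated branches of `C` containing `α`:
`B_0 = C` and `B_{i+1} = {x ∈ B_i : ‖x - α‖ < μ(B_i)}`. -/
noncomputable def branchIter {p : ℕ} [Fact p.Prime] (α : ℚ_[p]) (C : Finset ℚ_[p]) :
    ℕ → Finset ℚ_[p]
  | 0 => C
  | n + 1 => (branchIter α C n).filter (fun x => ‖x - α‖ < mu (branchIter α C n))

section Diameter

variable {p : ℕ} [Fact p.Prime] {C : Finset ℚ_[p]} {α : ℚ_[p]}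

theorem norm_sub_le_mu {x y : ℚ_[p]} (hx : x ∈ C) (hy : y ∈ C) : ‖x - y‖ ≤ mu C := by
  rw [mu, dif_pos ⟨x, hx⟩]
  exact Finset.le_sup' (fun xy : ℚ_[p] × ℚ_[p] => ‖xy.1 - xy.2‖)
    (Finset.mk_mem_product hx hy)

theorem mu_pos (hα : α ∈ C) (hne : C ≠ {α}) : 0 < mu C := by
  obtain ⟨x, hx, hxα⟩ : ∃ x ∈ C, x ≠ α := by
    by_contra! h
    exact hne (Finset.eq_singleton_iff_unique_mem.2 ⟨hα, h⟩)
  exact (norm_pos_iff.2 (sub_ne_zero.2 hxα)).trans_le (norm_sub_le_mu hx hα)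

/-- By the ultrametric inequality the diameter is attained from any point of the set. -/
theorem exists_norm_sub_eq_mu (hα : α ∈ C) : ∃ x ∈ C, ‖x - α‖ = mu C := by
  have hC : C.Nonempty := ⟨α, hα⟩
  obtain ⟨⟨a, b⟩, hab, hmu⟩ := Finset.exists_mem_eq_sup' (hC.product hC)
    (fun xy : ℚ_[p] × ℚ_[p] => ‖xy.1 - xy.2‖)
  obtain ⟨ha, hb⟩ := Finset.mem_product.1 hab
  have hmu' : mu C = ‖a - b‖ := by rw [mu, dif_pos hC]; exact hmu
  have hmax : ‖a - b‖ ≤ max ‖a - α‖ ‖b - α‖ := by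
    have h := IsUltrametricDist.norm_add_le_max (a - α) (α - b)
    rwa [sub_add_sub_cancel, norm_sub_rev α b] at h
  rcases le_max_iff.1 hmax with h | h
  · exact ⟨a, ha, (norm_sub_le_mu ha hα).antisymm (hmu' ▸ h)⟩
  · exact ⟨b, hb, (norm_sub_le_mu hb hα).antisymm (hmu' ▸ h)⟩

theorem branchIter_one_ssubset (hα : α ∈ C) : branchIter α C 1 ⊂ C := by
  obtain ⟨x, hx, hxmu⟩ := exists_norm_sub_eq_mu hα
  exact Finset.filter_ssubset.2 ⟨x, hx, hxmu.not_lt⟩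

theorem mem_branchIter_one (hα : α ∈ C) (hne : C ≠ {α}) : α ∈ branchIter α C 1 :=
  Finset.mem_filter.2 ⟨hα, by simpa [branchIter] using mu_pos hα hne⟩

theorem branchIter_succ_eq (α : ℚ_[p]) (C : Finset ℚ_[p]) (n : ℕ) :
    branchIter α C (n + 1) = branchIter α (branchIter α C 1) n := by
  induction n with
  | zero => rfl
  | succ n ih => rw [branchIter, ih]; rfl

theorem sum_norm_sub_eq_add_branchIter_one (hα : α ∈ C) :
    ∑ x ∈ C, ‖x - α‖ =
      ((C.card : ℝ) - ((branchIter α C 1).card : ℝ)) * mu C +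
        ∑ x ∈ branchIter α C 1, ‖x - α‖ := by
  have hsub : branchIter α C 1 ⊆ C := (branchIter_one_ssubset hα).subset
  rw [← Finset.sum_sdiff hsub, ← Finset.cast_card_sdiff hsub, ← nsmul_eq_mul]
  congr 1
  refine Finset.sum_eq_card_nsmul fun x hx => ?_
  obtain ⟨hxC, hxB⟩ := Finset.mem_sdiff.1 hx
  refine (norm_sub_le_mu hxC hα).antisymm (not_lt.1 fun h => hxB ?_)
  exact Finset.mem_filter.2 ⟨hxC, h⟩

end Diameter

/-- For a finite nonempty `C ⊆ ℚ_p` and `α ∈ C`, the iterated branches `B_i` of `C`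
containing `α` strictly decrease until some `B_N = {α}`, and the energy of `C` with
center `α` decomposes as `Σ_{x∈C} ‖x - α‖ = Σ_{i<N} (#B_i - #B_{i+1})·μ(B_i)`. -/
theorem energy_eq_sum_branch_decomposition {p : ℕ} [Fact p.Prime]
    (C : Finset ℚ_[p]) (hC : C.Nonempty) (α : ℚ_[p]) (hα : α ∈ C) :
    ∃ N : ℕ, branchIter α C N = {α} ∧
      (∀ i < N, branchIter α C (i + 1) ⊂ branchIter α C i) ∧
      ∑ x ∈ C, ‖x - α‖ =
        ∑ i ∈ Finset.range N,
          (((branchIter α C i).card : ℝ) - ((branchIter α C (i + 1)).card : ℝ)) *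
            mu (branchIter α C i) := by
  induction C using Finset.strongInduction with
  | H C ih =>
    by_cases hne : C = {α}
    · exact ⟨0, hne, by simp, by simp [hne]⟩
    · have hmem := mem_branchIter_one hα hne
      obtain ⟨N, hN, hlt, hsum⟩ := ih _ (branchIter_one_ssubset hα) ⟨α, hmem⟩ hmem
      refine ⟨N + 1, by rw [branchIter_succ_eq, hN], ?_, ?_⟩
      · rintro (_ | i) hi
        · exact branchIter_one_ssubset hα
        · rw [branchIter_succ_eq α C (i + 1), branchIter_succ_eq α C i]
          exact hlt i (Nat.lt_of_succ_lt_succ hi)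
      · rw [sum_norm_sub_eq_add_branchIter_one hα, hsum, Finset.sum_range_succ', add_comm]
        congr 1
        refine Finset.sum_congr rfl fun i _ => ?_
        rw [branchIter_succ_eq α C (i + 1), branchIter_succ_eq α C i]
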